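/- For positive integers n, m, h, let R₂₂ = h·𝟙_m𝟙_mᵀ + K with K ∈ ℝ^{m×m}, K_{ij} = min(i,j), let v = (1, 2, …, n)ᵀ ∈ ℝ^n, and let R₁₂ = v·𝟙_mᵀ ∈ ℝ^{n×m} and R₂₁ = R₁₂ᵀ. Then R₁₂ R₂₂^{-1} R₂₁ = (1/(1+h))·v vᵀ; i.e., it is the n×n matrix with (i,j) entry i·j/(1+h). -/

import Mathlib

open Finset Matrix

/-- The matrix `c + min (i, j)`, with indices starting at `0`, factors as `L D Lᵀ`, where `L` is the
lower triangular all-ones matrix and `D = diag (c, 1, …, 1)`. -/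
theorem of_add_min_eq_mul_diagonal_mul_transpose (k : ℕ) (c : ℝ) :
    (of fun i j : Fin (k + 1) => c + ((min (i : ℕ) (j : ℕ) : ℕ) : ℝ)) =
      (of fun i j : Fin (k + 1) => if j ≤ i then (1 : ℝ) else 0) *
        diagonal (fun i => if i = 0 then c else 1) *
          (of fun i j : Fin (k + 1) => if j ≤ i then (1 : ℝ) else 0)ᵀ := by
  ext i j
  have hterm : ∀ l : Fin (k + 1),
      ((if l ≤ i then (1 : ℝ) else 0) * if l = 0 then c else 1) * (if l ≤ j then 1 else 0) =
        (if l ∈ Iic (min i j) then 1 else 0) + (if l = 0 then c - 1 else 0) := by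
    intro l
    by_cases hl : l = 0
    · subst hl
      simp
    · by_cases hi : l ≤ i <;> by_cases hj : l ≤ j <;> simp [hl, hi, hj]
  rw [mul_apply]
  simp only [mul_diagonal, of_apply, transpose_apply, hterm, sum_add_distrib]
  rw [sum_ite_mem, univ_inter, sum_ite_eq' univ (0 : Fin (k + 1))]
  simp [Fin.card_Iic]
  ring

theorem isUnit_det_of_add_min (k : ℕ) {c : ℝ} (hc : c ≠ 0) :
    IsUnit (of fun i j : Fin (k + 1) => c + ((min (i : ℕ) (j : ℕ) : ℕ) : ℝ)).det := by
  have hL : (of fun i j : Fin (k + 1) => if j ≤ i then (1 : ℝ) else 0).det = 1 := by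
    rw [det_of_isLowerTriangular]
    · simp
    · intro i j hij
      have : i < j := hij
      simp [this]
  rw [of_add_min_eq_mul_diagonal_mul_transpose, det_mul, det_mul, det_transpose, hL, det_diagonal,
    isUnit_iff_ne_zero, one_mul, mul_one, prod_ne_zero_iff]
  intro i _
  split_ifs
  · exact hc
  · exact one_ne_zero

/-- The column of index `0` of the matrix `c + min (i, j)` is constant, so the inverse matrix sends
the all-ones vector to a multiple of the first basis vector. -/
theorem inv_of_add_min_mulVec_one (k : ℕ) {c : ℝ} (hc : c ≠ 0) :
    (of fun i j : Fin (k + 1) => c + ((min (i : ℕ) (j : ℕ) : ℕ) : ℝ))⁻¹ *ᵥ (fun _ => 1) =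
      Pi.single 0 c⁻¹ := by
  set R : Matrix (Fin (k + 1)) (Fin (k + 1)) ℝ :=
    of fun i j => c + ((min (i : ℕ) (j : ℕ) : ℕ) : ℝ) with hR
  have hcol : R *ᵥ Pi.single 0 c⁻¹ = fun _ => 1 := by
    ext i
    simp [hR, hc]
  rw [← hcol, mulVec_mulVec, nonsing_inv_mul R (isUnit_det_of_add_min k hc), one_mulVec]

/-- For positive integers `n, m, h`, let `R₂₂ = h·𝟙𝟙ᵀ + K` with
`K_{ij} = min(i,j)` (1-indexed, `m×m`), let `v = (1, 2, …, n)ᵀ`, `R₁₂ = v·𝟙ᵀ ∈ ℝ^{n×m}`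
and `R₂₁ = R₁₂ᵀ`.  Then `R₁₂ R₂₂⁻¹ R₂₁ = (1/(1+h))·v vᵀ`, i.e. the `n×n` matrix with
(1-indexed) `(i,j)` entry `i·j/(1+h)`. -/
theorem stmt8 (n m h : ℕ) (hn : 0 < n) (hm : 0 < m) (hh : 0 < h)
    (K : Matrix (Fin m) (Fin m) ℝ)
    (hK : ∀ i j : Fin m, K i j = (min ((i : ℕ) + 1) ((j : ℕ) + 1) : ℕ))
    (R22 : Matrix (Fin m) (Fin m) ℝ)
    (hR22 : R22 = (h : ℝ) • vecMulVec (fun _ => (1 : ℝ)) (fun _ => (1 : ℝ)) + K)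
    (v : Fin n → ℝ) (hv : ∀ i : Fin n, v i = (i : ℕ) + 1)
    (R12 : Matrix (Fin n) (Fin m) ℝ)
    (hR12 : R12 = vecMulVec v (fun _ => (1 : ℝ))) :
    R12 * R22⁻¹ * R12ᵀ = (1 / (1 + h : ℝ)) • vecMulVec v v ∧
      ∀ i j : Fin n, (R12 * R22⁻¹ * R12ᵀ) i j = (((i : ℕ) + 1) * ((j : ℕ) + 1) : ℝ) / (1 + h) := by
  obtain ⟨k, rfl⟩ := Nat.exists_eq_succ_of_ne_zero hm.ne'
  have hc : (1 + h : ℝ) ≠ 0 := by positivity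
  have hR : R22 = of fun i j : Fin (k + 1) =>
      (1 + h : ℝ) + ((min (i : ℕ) (j : ℕ) : ℕ) : ℝ) := by
    ext i j
    rw [hR22, Matrix.add_apply, hK, Nat.add_min_add_right]
    simp [vecMulVec_apply]
    ring
  have hmain : R12 * R22⁻¹ * R12ᵀ = (1 / (1 + h : ℝ)) • vecMulVec v v := by
    rw [hR12, transpose_vecMulVec, Matrix.mul_assoc, mul_vecMulVec, hR,
      inv_of_add_min_mulVec_one k hc, vecMulVec_mul_vecMulVec]
    ext i j
    simp [vecMulVec_apply]
    ring
  refine ⟨hmain, fun i j => ?_⟩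
  rw [hmain, Matrix.smul_apply, vecMulVec_apply, hv, hv, smul_eq_mul]
  ring
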